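/- Let Ubar ∈ ℝ^{N×n} have orthonormal columns and let F ∈ ℝ^{N×w} have rank n with all columns lying in the column span of Ubar. Let U ∈ ℝ^{N×n}, let P ∈ ℝ^{N×n} be an interpolation points matrix with PᵀU invertible and PᵀF of rank n, and set C = (PᵀU)^{-1}PᵀF and R = UC − F. Let S ∈ ℝ^{N×m} be a sampling points matrix with complementary matrix Sbreve, let rbar be the rank of SᵀR with nonzero singular values σ_1 ≥ … ≥ σ_rbar > 0, and let r ≤ rbar. Suppose ΔU ∈ ℝ^{N×n} satisfies SbreveᵀΔU = 0 and ‖Sᵀ((U + ΔU)C − F)‖_F² ≤ ‖SᵀR‖_F² − Σ_{i=1}^{r} σ_i², and suppose U + ΔU has rank n with column span spanned by an orthonormal basis matrix Uhat ∈ ℝ^{N×n}. Then ‖Ubar − Uhat Uhatᵀ Ubar‖_F² ≤ ρ² / σ_min(F)², where ρ² = ‖Sbreveᵀ R‖_F² + Σ_{i=r+1}^{rbar} σ_i² and σ_min(F) is the smallest nonzero singular value of F. -/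

import Mathlib

open Matrix Finset

/-- Squared Frobenius norm of a real matrix. -/
noncomputable def frobSq {m k : ℕ} (A : Matrix (Fin m) (Fin k) ℝ) : ℝ :=
  ∑ i, ∑ j, A i j ^ 2

/-- The matrix `[e_{s 0}, …, e_{s (m-1)}] ∈ ℝ^{N×m}` whose columns are the canonical
unit vectors of `ℝ^N` selected by `s`. -/
noncomputable def samplingMatrix {N m : ℕ} (s : Fin m → Fin N) : Matrix (Fin N) (Fin m) ℝ :=
  Matrix.of fun i k => if i = s k then 1 else 0

/-- `σ : Fin r → ℝ` is the (decreasingly sorted) list of nonzero singular values of `M`. -/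
def IsSingularValues {m k : ℕ} (M : Matrix (Fin m) (Fin k) ℝ) (r : ℕ) (σ : Fin r → ℝ) : Prop :=
  (∀ i, 0 < σ i) ∧ Antitone σ ∧
  ∃ (u : Fin r → Fin m → ℝ) (v : Fin r → Fin k → ℝ),
    (∀ i j, u i ⬝ᵥ u j = if i = j then (1 : ℝ) else 0) ∧
    (∀ i j, v i ⬝ᵥ v j = if i = j then (1 : ℝ) else 0) ∧
    M = ∑ i, σ i • Matrix.vecMulVec (u i) (v i)

theorem frobSq_eq_trace {m k : ℕ} (A : Matrix (Fin m) (Fin k) ℝ) :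
    frobSq A = (Aᵀ * A).trace := by
  simp only [frobSq, Matrix.trace, Matrix.diag, Matrix.mul_apply, Matrix.transpose_apply]
  rw [Finset.sum_comm]
  simp only [sq]

theorem frobSq_nonneg {m k : ℕ} (A : Matrix (Fin m) (Fin k) ℝ) : 0 ≤ frobSq A :=
  Finset.sum_nonneg fun _ _ => Finset.sum_nonneg fun _ _ => sq_nonneg _

theorem frobSq_neg {m k : ℕ} (A : Matrix (Fin m) (Fin k) ℝ) : frobSq (-A) = frobSq A := by
  simp [frobSq]

/-- Left multiplication by a matrix with orthonormal columns preserves the Frobenius norm. -/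
theorem frobSq_orthonormal_mul {l m k : ℕ} {V : Matrix (Fin l) (Fin m) ℝ} (hV : Vᵀ * V = 1)
    (A : Matrix (Fin m) (Fin k) ℝ) : frobSq (V * A) = frobSq A := by
  rw [frobSq_eq_trace, frobSq_eq_trace, Matrix.transpose_mul, Matrix.mul_assoc,
    ← Matrix.mul_assoc Vᵀ, hV, Matrix.one_mul]

/-- Right multiplication by the transpose of a matrix with orthonormal columns preserves the
Frobenius norm. -/
theorem frobSq_mul_orthonormal_transpose {l m k : ℕ} {V : Matrix (Fin l) (Fin m) ℝ}
    (hV : Vᵀ * V = 1) (A : Matrix (Fin k) (Fin m) ℝ) : frobSq (A * Vᵀ) = frobSq A := by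
  rw [frobSq_eq_trace, frobSq_eq_trace, Matrix.transpose_mul, Matrix.transpose_transpose,
    Matrix.mul_assoc, Matrix.trace_mul_comm, Matrix.mul_assoc, Matrix.mul_assoc, hV,
    Matrix.mul_one]

/-- Removing the orthogonal projection onto a column span does not increase the Frobenius
norm. -/
theorem frobSq_sub_proj_le {l m k : ℕ} {V : Matrix (Fin l) (Fin m) ℝ} (hV : Vᵀ * V = 1)
    (A : Matrix (Fin l) (Fin k) ℝ) : frobSq (A - V * Vᵀ * A) ≤ frobSq A := by
  have h : (A - V * Vᵀ * A)ᵀ * (A - V * Vᵀ * A) = Aᵀ * A - (Vᵀ * A)ᵀ * (Vᵀ * A) := by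
    have h' : Vᵀ * (V * (Vᵀ * A)) = Vᵀ * A := by
      rw [← Matrix.mul_assoc, hV, Matrix.one_mul]
    simp only [Matrix.transpose_sub, Matrix.transpose_mul, Matrix.transpose_transpose,
      Matrix.sub_mul, Matrix.mul_sub, Matrix.mul_assoc, h']
    abel
  have h0 := frobSq_nonneg (Vᵀ * A)
  rw [frobSq_eq_trace] at h0
  rw [frobSq_eq_trace, frobSq_eq_trace, h, Matrix.trace_sub]
  linarith

theorem samplingMatrix_transpose_mul {N m k : ℕ} (s : Fin m → Fin N)
    (A : Matrix (Fin N) (Fin k) ℝ) : (samplingMatrix s)ᵀ * A = A.submatrix s id := by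
  ext i j
  simp [samplingMatrix, Matrix.mul_apply]

/-- The Frobenius norm splits over complementary sets of rows. -/
theorem frobSq_eq_sampling_add_compl {N m l k : ℕ} {s : Fin m → Fin N}
    (hs : Function.Injective s) {sb : Fin l → Fin N} (hsb : Function.Injective sb)
    (hcompl : Set.range sb = (Set.range s)ᶜ) (A : Matrix (Fin N) (Fin k) ℝ) :
    frobSq A = frobSq ((samplingMatrix s)ᵀ * A) + frobSq ((samplingMatrix sb)ᵀ * A) := by
  have himg : Finset.univ.image sb = (Finset.univ.image s)ᶜ := by
    ext x
    simpa using Set.ext_iff.mp hcompl x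
  rw [samplingMatrix_transpose_mul, samplingMatrix_transpose_mul]
  simp only [frobSq, Matrix.submatrix_apply, id]
  rw [← Finset.sum_add_sum_compl (Finset.univ.image s), ← himg,
    Finset.sum_image hs.injOn, Finset.sum_image hsb.injOn]

/-- A singular value list yields a matrix factorization. -/
theorem IsSingularValues.exists_factorization {m k r : ℕ} {M : Matrix (Fin m) (Fin k) ℝ}
    {σ : Fin r → ℝ} (h : IsSingularValues M r σ) :
    ∃ (W : Matrix (Fin m) (Fin r) ℝ) (V : Matrix (Fin k) (Fin r) ℝ),
      Wᵀ * W = 1 ∧ Vᵀ * V = 1 ∧ M = W * Matrix.diagonal σ * Vᵀ := by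
  obtain ⟨-, -, u, v, hu, hv, hM⟩ := h
  refine ⟨(Matrix.of u)ᵀ, (Matrix.of v)ᵀ, ?_, ?_, ?_⟩
  · ext i j
    simpa [Matrix.mul_apply, dotProduct, Matrix.one_apply] using hu i j
  · ext i j
    simpa [Matrix.mul_apply, dotProduct, Matrix.one_apply] using hv i j
  · rw [hM]
    ext i j
    simp only [Matrix.sum_apply, Matrix.smul_apply, Matrix.vecMulVec_apply, smul_eq_mul,
      Matrix.transpose_transpose]
    rw [Matrix.mul_apply]
    refine Finset.sum_congr rfl fun x _ => ?_
    rw [Matrix.mul_diagonal]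
    simp only [Matrix.transpose_apply, Matrix.of_apply]
    ring

theorem frobSq_mul_diagonal {m r : ℕ} (A : Matrix (Fin m) (Fin r) ℝ) (σ : Fin r → ℝ) :
    frobSq (A * Matrix.diagonal σ) = ∑ i, ∑ j, A i j ^ 2 * σ j ^ 2 := by
  simp only [frobSq, Matrix.mul_diagonal, mul_pow]

theorem IsSingularValues.frobSq_eq {m k r : ℕ} {M : Matrix (Fin m) (Fin k) ℝ}
    {σ : Fin r → ℝ} (h : IsSingularValues M r σ) : frobSq M = ∑ i, σ i ^ 2 := by
  obtain ⟨W, V, hW, hV, rfl⟩ := h.exists_factorization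
  rw [frobSq_mul_orthonormal_transpose hV, frobSq_orthonormal_mul hW]
  simp [frobSq, Matrix.diagonal_apply, ite_pow]

/-- If the columns of `F = B * G` span those of the orthonormal matrix `B`, then a lower bound `c`
on the singular values of `F` controls the image of `B` under any `T`. -/
theorem IsSingularValues.mul_frobSq_le {N n w : ℕ} {B : Matrix (Fin N) (Fin n) ℝ}
    (hB : Bᵀ * B = 1) {G : Matrix (Fin n) (Fin w) ℝ} {σ : Fin n → ℝ}
    (h : IsSingularValues (B * G) n σ) {c : ℝ} (hc : 0 ≤ c) (hcσ : ∀ i, c ≤ σ i)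
    (T : Matrix (Fin N) (Fin N) ℝ) : c ^ 2 * frobSq (T * B) ≤ frobSq (T * (B * G)) := by
  have hpos := h.1
  obtain ⟨W, V, hW, hV, hF⟩ := h.exists_factorization
  have hWQ : W = B * (G * V * Matrix.diagonal fun i => (σ i)⁻¹) := by
    have hinv : Matrix.diagonal σ * Matrix.diagonal (fun i => (σ i)⁻¹) = 1 := by
      rw [Matrix.diagonal_mul_diagonal, ← Matrix.diagonal_one]
      exact congrArg _ (funext fun i => mul_inv_cancel₀ (hpos i).ne')
    rw [← Matrix.mul_assoc, ← Matrix.mul_assoc, hF, Matrix.mul_assoc _ Vᵀ, hV, Matrix.mul_one,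
      Matrix.mul_assoc, hinv, Matrix.mul_one]
  set Q := G * V * Matrix.diagonal fun i => (σ i)⁻¹
  have hQ : Qᵀ * Q = 1 := by
    rw [← hW, hWQ, Matrix.transpose_mul B Q, Matrix.mul_assoc, ← Matrix.mul_assoc Bᵀ, hB,
      Matrix.one_mul]
  have hQ' : Qᵀᵀ * Qᵀ = 1 := by
    rw [Matrix.transpose_transpose]
    exact mul_eq_one_comm.mp hQ
  have hTB : frobSq (T * B) = frobSq (T * W) := by
    rw [hWQ, ← Matrix.mul_assoc, ← frobSq_mul_orthonormal_transpose hQ' (T * B),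
      Matrix.transpose_transpose]
  rw [hTB, hF, ← Matrix.mul_assoc, frobSq_mul_orthonormal_transpose hV, ← Matrix.mul_assoc,
    frobSq_mul_diagonal, frobSq, Finset.mul_sum]
  refine Finset.sum_le_sum fun i _ => ?_
  rw [Finset.mul_sum]
  refine Finset.sum_le_sum fun j _ => ?_
  rw [mul_comm]
  exact mul_le_mul_of_nonneg_left (pow_le_pow_left₀ hc (hcσ j) 2) (sq_nonneg _)

/-- (Proposition 3.2.)  Error bound for the adapted space:
`d(Ubar, Uhat) = ‖Ubar − Uhat Uhatᵀ Ubar‖_F² ≤ ρ² / σ_min(F)²` with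
`ρ² = ‖Sbreveᵀ R‖_F² + ∑_{i=r+1}^{rbar} σ_i²`, where `Uhat` is an orthonormal basis
matrix of the column span of the adapted matrix `U + ΔU`. -/
theorem adapted_space_error_bound
    {N n w m : ℕ} (hn : 0 < n)
    (Ubar : Matrix (Fin N) (Fin n) ℝ) (hUbar : Ubarᵀ * Ubar = 1)
    (F : Matrix (Fin N) (Fin w) ℝ)
    (hFspan : ∃ G : Matrix (Fin n) (Fin w) ℝ, F = Ubar * G)
    (σF : Fin n → ℝ) (hσF : IsSingularValues F n σF)
    (U : Matrix (Fin N) (Fin n) ℝ)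
    (p : Fin n → Fin N) (hp : Function.Injective p)
    (hPU : IsUnit ((samplingMatrix p)ᵀ * U))
    (hPF : ((samplingMatrix p)ᵀ * F).rank = n)
    (C : Matrix (Fin n) (Fin w) ℝ)
    (hC : C = ((samplingMatrix p)ᵀ * U)⁻¹ * ((samplingMatrix p)ᵀ * F))
    (R : Matrix (Fin N) (Fin w) ℝ) (hR : R = U * C - F)
    (s : Fin m → Fin N) (hs : Function.Injective s)
    (sb : Fin (N - m) → Fin N) (hsb : Function.Injective sb)
    (hcompl : Set.range sb = (Set.range s)ᶜ)
    (rbar : ℕ) (σ : Fin rbar → ℝ)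
    (hσ : IsSingularValues ((samplingMatrix s)ᵀ * R) rbar σ)
    (r : ℕ) (hr : r ≤ rbar)
    (ΔU : Matrix (Fin N) (Fin n) ℝ)
    (h1 : (samplingMatrix sb)ᵀ * ΔU = 0)
    (h2 : frobSq ((samplingMatrix s)ᵀ * ((U + ΔU) * C - F)) ≤
      frobSq ((samplingMatrix s)ᵀ * R) -
        ∑ i : Fin rbar, if (i : ℕ) < r then σ i ^ 2 else 0)
    (Uhat : Matrix (Fin N) (Fin n) ℝ) (hUhat : Uhatᵀ * Uhat = 1)
    (hspan : ∃ G : Matrix (Fin n) (Fin n) ℝ, IsUnit G ∧ U + ΔU = Uhat * G) :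
    frobSq (Ubar - Uhat * Uhatᵀ * Ubar) ≤
      (frobSq ((samplingMatrix sb)ᵀ * R) +
          ∑ i : Fin rbar, if r ≤ (i : ℕ) then σ i ^ 2 else 0) /
        σF ⟨n - 1, Nat.sub_lt hn one_pos⟩ ^ 2 := by
  obtain ⟨G, hG⟩ := hFspan
  obtain ⟨H, -, hH⟩ := hspan
  set c := σF ⟨n - 1, Nat.sub_lt hn one_pos⟩
  have hcpos : 0 < c := hσF.1 _
  have hcle : ∀ i, c ≤ σF i := fun i =>
    hσF.2.1 (Fin.le_def.mpr (Nat.le_sub_one_of_lt i.isLt))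
  have hres : frobSq ((U + ΔU) * C - F) ≤ frobSq ((samplingMatrix sb)ᵀ * R) +
      ∑ i : Fin rbar, if r ≤ (i : ℕ) then σ i ^ 2 else 0 := by
    have hsbR : (samplingMatrix sb)ᵀ * ((U + ΔU) * C - F) = (samplingMatrix sb)ᵀ * R := by
      have h1C : (samplingMatrix sb)ᵀ * (ΔU * C) = 0 := by
        rw [← Matrix.mul_assoc, h1, Matrix.zero_mul]
      rw [hR, Matrix.add_mul, Matrix.mul_sub, Matrix.mul_add, h1C, add_zero, Matrix.mul_sub]
    have hsplit : frobSq ((samplingMatrix s)ᵀ * R) =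
        (∑ i : Fin rbar, if (i : ℕ) < r then σ i ^ 2 else 0) +
          ∑ i : Fin rbar, if r ≤ (i : ℕ) then σ i ^ 2 else 0 := by
      rw [hσ.frobSq_eq, ← Finset.sum_add_distrib]
      refine Finset.sum_congr rfl fun i _ => ?_
      by_cases hi : (i : ℕ) < r
      · simp [hi]
      · simp [hi, not_lt.mp hi]
    rw [frobSq_eq_sampling_add_compl hs hsb hcompl, hsbR]
    linarith
  have hproj : ∀ {k : ℕ} (A : Matrix (Fin N) (Fin k) ℝ),
      (1 - Uhat * Uhatᵀ) * A = A - Uhat * Uhatᵀ * A := fun A => by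
    rw [Matrix.sub_mul, Matrix.one_mul]
  have hF : (1 - Uhat * Uhatᵀ) * F =
      -(((U + ΔU) * C - F) - Uhat * Uhatᵀ * ((U + ΔU) * C - F)) := by
    have hker : Uhat * Uhatᵀ * (Uhat * H * C) = Uhat * H * C := by
      rw [Matrix.mul_assoc, Matrix.mul_assoc Uhat H, ← Matrix.mul_assoc Uhatᵀ, hUhat,
        Matrix.one_mul]
    rw [hproj, hH, Matrix.mul_sub, hker]
    abel
  have hmain : c ^ 2 * frobSq ((1 - Uhat * Uhatᵀ) * Ubar) ≤ frobSq ((1 - Uhat * Uhatᵀ) * F) := by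
    subst hG
    exact hσF.mul_frobSq_le hUbar hcpos.le hcle _
  rw [hF, frobSq_neg, hproj] at hmain
  rw [le_div_iff₀ (pow_pos hcpos 2), mul_comm]
  exact hmain.trans ((frobSq_sub_proj_le hUhat _).trans hres)
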